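/- arXiv:2410.07465 — 2 statements merged into one kernel-verified Lean document; each statement's English description precedes it below -/
import Mathlib

section
/- One-step error recursion: Let L be an ℝ-linear map on real m₁×m₂ matrices with ⟨L(Z), Z⟩ ≤ α‖Z‖² for all Z, and let c > 0. Then there exist Δt₀ > 0 and constants C₁, C₂ > 0, depending only on α and c, such that for all 0 < Δt ≤ Δt₀ and all matrices e, ẽ, s with ẽ − e = Δt·L((e + ẽ)/2) + s and ‖s‖ ≤ c·Δt², one has ‖ẽ‖² ≤ (1 + C₁·Δt)·‖e‖² + C₂·Δt³. -/
/-- Frobenius inner product on real `m₁ × m₂` matrices. -/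
def finner {m₁ m₂ : ℕ} (A B : Matrix (Fin m₁) (Fin m₂) ℝ) : ℝ :=
  ∑ i, ∑ j, A i j * B i j

/-- Frobenius norm on real `m₁ × m₂` matrices. -/
noncomputable def fnorm {m₁ m₂ : ℕ} (A : Matrix (Fin m₁) (Fin m₂) ℝ) : ℝ :=
  Real.sqrt (∑ i, ∑ j, (A i j) ^ 2)

theorem fnorm_sq_eq {m₁ m₂ : ℕ} (A : Matrix (Fin m₁) (Fin m₂) ℝ) :
    (fnorm A) ^ 2 = finner A A := by
  unfold fnorm finner
  have h : 0 ≤ ∑ i, ∑ j, (A i j) ^ 2 :=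
    Finset.sum_nonneg fun i _ => Finset.sum_nonneg fun j _ => sq_nonneg _
  refine (Real.sq_sqrt h).trans ?_
  exact Finset.sum_congr rfl fun i _ => Finset.sum_congr rfl fun j _ => sq _

theorem finner_diff {m₁ m₂ : ℕ} (e et : Matrix (Fin m₁) (Fin m₂) ℝ) :
    finner et et - finner e e = 2 * finner (et - e) ((2 : ℝ)⁻¹ • (e + et)) := by
  simp only [finner, Finset.mul_sum, ← Finset.sum_sub_distrib]
  refine Finset.sum_congr rfl fun i _ => Finset.sum_congr rfl fun j _ => ?_
  simp only [Matrix.sub_apply, Matrix.smul_apply, Matrix.add_apply, smul_eq_mul]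
  ring

theorem finner_lin {m₁ m₂ : ℕ} (t : ℝ) (a s z : Matrix (Fin m₁) (Fin m₂) ℝ) :
    finner (t • a + s) z = t * finner a z + finner s z := by
  simp only [finner, Finset.mul_sum, ← Finset.sum_add_distrib]
  refine Finset.sum_congr rfl fun i _ => Finset.sum_congr rfl fun j _ => ?_
  simp only [Matrix.smul_apply, Matrix.add_apply, smul_eq_mul]
  ring

theorem finner_young {m₁ m₂ : ℕ} (t : ℝ) (s z : Matrix (Fin m₁) (Fin m₂) ℝ) :
    2 * t * finner s z ≤ finner s s + t ^ 2 * finner z z := by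
  simp only [finner, Finset.mul_sum, ← Finset.sum_add_distrib]
  refine Finset.sum_le_sum fun i _ => Finset.sum_le_sum fun j _ => ?_
  nlinarith [sq_nonneg (s i j - t * z i j)]

theorem finner_mid {m₁ m₂ : ℕ} (e et : Matrix (Fin m₁) (Fin m₂) ℝ) :
    2 * finner ((2 : ℝ)⁻¹ • (e + et)) ((2 : ℝ)⁻¹ • (e + et)) ≤ finner e e + finner et et := by
  simp only [finner, Finset.mul_sum, ← Finset.sum_add_distrib]
  refine Finset.sum_le_sum fun i _ => Finset.sum_le_sum fun j _ => ?_
  simp only [Matrix.smul_apply, Matrix.add_apply, smul_eq_mul]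
  nlinarith [sq_nonneg (e i j - et i j)]

/-- One-step error recursion for the perturbed implicit-midpoint step. -/
theorem one_step_error_recursion (α c : ℝ) (hc : 0 < c) :
    ∃ Δt₀ > (0 : ℝ), ∃ C₁ > (0 : ℝ), ∃ C₂ > (0 : ℝ),
      ∀ (m₁ m₂ : ℕ)
        (L : Matrix (Fin m₁) (Fin m₂) ℝ →ₗ[ℝ] Matrix (Fin m₁) (Fin m₂) ℝ),
        (∀ Z : Matrix (Fin m₁) (Fin m₂) ℝ, finner (L Z) Z ≤ α * (fnorm Z) ^ 2) →
        ∀ Δt : ℝ, 0 < Δt → Δt ≤ Δt₀ →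
        ∀ e et s : Matrix (Fin m₁) (Fin m₂) ℝ,
          et - e = Δt • L ((2 : ℝ)⁻¹ • (e + et)) + s →
          fnorm s ≤ c * Δt ^ 2 →
          (fnorm et) ^ 2 ≤ (1 + C₁ * Δt) * (fnorm e) ^ 2 + C₂ * Δt ^ 3 := by
  obtain ⟨k, hk⟩ : ∃ k : ℝ, k = |α| + 1 / 2 := ⟨_, rfl⟩
  have hk0 : 0 < k := by have := abs_nonneg α; linarith
  refine ⟨1 / (2 * k), by positivity, 4 * k, by positivity, 2 * c ^ 2, by positivity, ?_⟩
  intro m₁ m₂ L hL t ht ht0 e et s heq hs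
  have hx : k * t ≤ 1 / 2 := by
    rw [le_div_iff₀ (by positivity)] at ht0
    linarith
  have hs2 : finner s s ≤ (c * t ^ 2) ^ 2 := by
    rw [← fnorm_sq_eq]
    exact pow_le_pow_left₀ (Real.sqrt_nonneg _) hs 2
  have hLz := hL ((2 : ℝ)⁻¹ • (e + et))
  have hd := finner_diff e et
  have hm := finner_mid e et
  rw [heq, finner_lin] at hd
  have hy := finner_young t s ((2 : ℝ)⁻¹ • (e + et))
  have hE : 0 ≤ finner e e := by rw [← fnorm_sq_eq]; positivity
  have hZ : 0 ≤ finner ((2 : ℝ)⁻¹ • (e + et)) ((2 : ℝ)⁻¹ • (e + et)) := by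
    rw [← fnorm_sq_eq]; positivity
  rw [fnorm_sq_eq] at hLz
  rw [fnorm_sq_eq, fnorm_sq_eq]
  generalize finner (L ((2 : ℝ)⁻¹ • (e + et))) ((2 : ℝ)⁻¹ • (e + et)) = l at *
  generalize finner s ((2 : ℝ)⁻¹ • (e + et)) = p at *
  generalize finner ((2 : ℝ)⁻¹ • (e + et)) ((2 : ℝ)⁻¹ • (e + et)) = Z at *
  generalize finner e e = E at *
  generalize finner et et = F at *
  have hp : 2 * p ≤ c ^ 2 * t ^ 3 + t * Z := by
    refine le_of_mul_le_mul_left ?_ ht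
    nlinarith
  have hl : l ≤ |α| * Z := hLz.trans (mul_le_mul_of_nonneg_right (le_abs_self α) hZ)
  have h1 : t * l ≤ t * (|α| * Z) := mul_le_mul_of_nonneg_left hl ht.le
  have h2 : (k * t) * (2 * Z) ≤ (k * t) * (E + F) :=
    mul_le_mul_of_nonneg_left hm (by positivity)
  have h3 : F - E ≤ (k * t) * (E + F) + c ^ 2 * t ^ 3 := by
    have : (k * t) * (2 * Z) = 2 * (t * (|α| * Z)) + t * Z := by rw [hk]; ring
    linarith
  have hx0 : 0 < k * t := by positivity
  have hq : 0 ≤ c ^ 2 * t ^ 3 := by positivity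
  rw [show (1 + 4 * k * t) * E + 2 * c ^ 2 * t ^ 3
    = (1 + 4 * (k * t)) * E + 2 * (c ^ 2 * t ^ 3) by ring]
  generalize c ^ 2 * t ^ 3 = q at *
  generalize k * t = x at *
  refine le_of_mul_le_mul_left ?_ (show 0 < 1 - x by linarith)
  have h4 : 0 ≤ x * (1 - 2 * x) * E := by
    have : 0 ≤ 1 - 2 * x := by linarith
    positivity
  have h5 : 0 ≤ (1 - 2 * x) * q := mul_nonneg (by linarith) hq
  nlinarith
end

section
/- Exponential sum approximation of 1/t (Sinc quadrature): Let δ₀, η ∈ (0,1) with δ* := δ₀ + η < 1, and let T > 1. Set α = 2π / (ln 3 + |ln(cos 1)| + |ln(δ₀/2)|), m = ⌈α⁻¹ · ln|ln(δ₀/2)|⌉, and n = ⌈α⁻¹ · (|ln(η/2)| + ln T)⌉. Define S(t) = α · Σ_{k=−n}^{m} e^{kα} · exp(−e^{kα}·t). Then for all t ∈ [1, T], |t⁻¹ − S(t)| ≤ δ* · t⁻¹. -/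
open Real

lemma es_gamma_sq (x : ℝ) (hx : 0 < x) :
    ‖Complex.Gamma (1 + x * Complex.I)‖ ^ 2 = π * x / Real.sinh (π * x) := by
  have hxI : (x : ℂ) * Complex.I ≠ 0 := by simp [hx.ne']
  have h1 := Complex.Gamma_add_one _ hxI
  have h2 := Complex.Gamma_mul_Gamma_one_sub ((x : ℂ) * Complex.I)
  have hc : (starRingEnd ℂ) (1 + x * Complex.I) = 1 - x * Complex.I := by
    simp [sub_eq_add_neg]
  have h3 := Complex.Gamma_conj (1 + x * Complex.I)
  rw [hc] at h3
  have hs : Real.sinh (π * x) ≠ 0 := by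
    have : 0 < π * x := by positivity
    exact (Real.sinh_pos_iff.mpr this).ne'
  have hs' : Complex.sinh (π * x) ≠ 0 := by exact_mod_cast hs
  have h4 : Complex.sin (π * (x * Complex.I)) = Complex.sinh (π * x) * Complex.I := by
    rw [← mul_assoc, Complex.sin_mul_I]
  have key : ((‖Complex.Gamma (1 + x * Complex.I)‖ ^ 2 : ℝ) : ℂ) =
      ((π * x / Real.sinh (π * x) : ℝ) : ℂ) := by
    push_cast
    rw [← Complex.mul_conj', ← h3, add_comm 1, h1, mul_assoc, h2, h4]
    field_simp
  exact_mod_cast key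

lemma es_gamma_bound_pos (x : ℝ) (hx : 1 ≤ x) :
    ‖Complex.Gamma (1 + x * Complex.I)‖ ≤ 2 * Real.exp (-x) := by
  have h := es_gamma_sq x (by linarith)
  refine (sq_le_sq₀ (norm_nonneg _) (by positivity)).mp ?_
  rw [h]
  have hpi := Real.pi_gt_d2
  have hpi2 := Real.pi_lt_d2
  have hs : 0 < Real.sinh (π * x) := Real.sinh_pos_iff.mpr (by positivity)
  rw [div_le_iff₀ hs, Real.sinh_eq]
  have e1 : (2 * Real.exp (-x)) ^ 2 * ((Real.exp (π * x) - Real.exp (-(π * x))) / 2)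
      = 2 * Real.exp ((π - 2) * x) - 2 * Real.exp (-(π + 2) * x) := by
    have a1 : Real.exp ((π - 2) * x) = Real.exp (-x) * Real.exp (-x) * Real.exp (π * x) := by
      rw [← Real.exp_add, ← Real.exp_add]; congr 1; ring
    have a2 : Real.exp (-(π + 2) * x) = Real.exp (-x) * Real.exp (-x) * Real.exp (-(π * x)) := by
      rw [← Real.exp_add, ← Real.exp_add]; congr 1; ring
    rw [a1, a2]; ring
  rw [e1]
  have b1 : Real.exp (-(π + 2) * x) ≤ 1 := by
    rw [Real.exp_le_one_iff]; nlinarith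
  have b2 : 2.7 * ((π - 2) * x) ≤ Real.exp ((π - 2) * x) := by
    have := Real.add_one_le_exp ((π - 2) * x - 1)
    have e := Real.exp_one_gt_d9
    have : Real.exp ((π - 2) * x) = Real.exp ((π - 2) * x - 1) * Real.exp 1 := by
      rw [← Real.exp_add]; congr 1; ring
    have : 0 ≤ (π - 2) * x := by nlinarith
    nlinarith
  nlinarith

lemma es_gamma_bound (x : ℝ) (hx : 1 ≤ |x|) :
    ‖Complex.Gamma (1 + x * Complex.I)‖ ≤ 2 * Real.exp (-|x|) := by
  rcases le_total 0 x with h | h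
  · rw [abs_of_nonneg h] at *; exact es_gamma_bound_pos x hx
  · rw [abs_of_nonpos h] at *
    have := es_gamma_bound_pos (-x) hx
    have hc : (1 + ((-x : ℝ) : ℂ) * Complex.I) = (starRingEnd ℂ) (1 + x * Complex.I) := by
      simp
    rw [hc, Complex.Gamma_conj, RCLike.norm_conj] at this
    exact this

/-- The integrand after the change of variables (reflected). -/
noncomputable def esG (a t x : ℝ) : ℝ :=
  Real.exp (-a * x) * Real.exp (-(t * Real.exp (-a * x)))

open FourierTransform in
lemma es_fourier (a t : ℝ) (ha : 0 < a) (ht : 0 < t) (j : ℤ) :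
    𝓕 (fun x : ℝ => ((esG a t x : ℝ) : ℂ)) (j : ℝ) =
      (a⁻¹ : ℝ) * ((1 / t : ℂ) ^ (1 + ((2 * π * j / a : ℝ) : ℂ) * Complex.I) *
        Complex.Gamma (1 + ((2 * π * j / a : ℝ) : ℂ) * Complex.I)) := by
  have ha' : (a : ℂ) ≠ 0 := by exact_mod_cast ha.ne'
  set s : ℂ := a + ((2 * π * j : ℝ) : ℂ) * Complex.I with hs
  have hre : s.re = a := by simp [hs]
  have him : s.im = 2 * π * j := by simp [hs]
  have h1 := mellin_eq_fourier (fun v : ℝ => Complex.exp (-(t * ((v ^ a : ℝ) : ℂ)))) (s := s)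
  rw [hre, him] at h1
  have h2 := mellin_comp_rpow (fun v : ℝ => Complex.exp (-(t * (v : ℂ)))) s a
  have hsa : s / a = 1 + ((2 * π * j / a : ℝ) : ℂ) * Complex.I := by
    rw [hs]; push_cast; field_simp
  have h3 := Complex.integral_cpow_mul_exp_neg_mul_Ioi (a := s / a) (r := t)
    (by rw [hsa]; simp) ht
  have h4 : mellin (fun v : ℝ => Complex.exp (-(t * (v : ℂ)))) (s / a) =
    (1 / t : ℂ) ^ (s / a) * Complex.Gamma (s / a) := by
    rw [← h3]; simp [mellin]
  have hj : 2 * π * (j : ℝ) / (2 * π) = j := by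
    field_simp
  rw [hj] at h1
  have hf : (fun x : ℝ => ((esG a t x : ℝ) : ℂ)) =
      fun u : ℝ => Real.exp (-a * u) • Complex.exp (-(t * (((Real.exp (-u)) ^ a : ℝ) : ℂ))) := by
    funext u
    rw [esG, ← Real.exp_mul]
    have : -u * a = -a * u := by ring
    rw [this, Complex.real_smul]
    push_cast
    rfl
  rw [hf, ← h1, h2, h4, hsa, abs_of_pos ha, Complex.real_smul]

lemma esG_bound (a t x : ℝ) (ha : 0 < a) (ht : 1 ≤ t) (hx : x ≠ 0) :
    esG a t x ≤ 4 / a ^ 2 * (1 / x ^ 2) := by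
  have h1 : esG a t x ≤ 2 * Real.exp (-(a * |x|)) := by
    set y := Real.exp (-a * x) with hy
    have hy0 : 0 < y := Real.exp_pos _
    have h0 : esG a t x ≤ y * Real.exp (-y) := by
      unfold esG; rw [← hy]; gcongr; nlinarith
    rcases le_total 0 x with h | h
    · rw [abs_of_nonneg h]
      have : Real.exp (-y) ≤ 1 := by simpa using hy0.le
      have : y = Real.exp (-(a * x)) := by rw [hy]; congr 1; ring
      rw [← this]; nlinarith
    · rw [abs_of_nonpos h]
      have e : Real.exp (-(a * -x)) = y⁻¹ := by
        rw [hy, ← Real.exp_neg]; congr 1; ring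
      rw [e]
      have q := Real.quadratic_le_exp_of_nonneg hy0.le
      refine h0.trans ?_
      rw [Real.exp_neg, ← div_eq_mul_inv, ← div_eq_mul_inv, div_le_div_iff₀ (Real.exp_pos _) hy0]
      nlinarith
  refine h1.trans ?_
  have hz : 0 < a * |x| := by positivity
  have q := Real.quadratic_le_exp_of_nonneg hz.le
  have : Real.exp (-(a * |x|)) ≤ 2 / (a * |x|) ^ 2 := by
    rw [Real.exp_neg, ← one_div, div_le_div_iff₀ (Real.exp_pos _) (by positivity)]
    nlinarith
  rw [mul_pow, sq_abs] at this
  calc _ ≤ 2 * (2 / (a ^ 2 * x ^ 2)) := by gcongr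
    _ = _ := by field_simp; norm_num

lemma es_hasSum_pow (q : ℝ) (h0 : 0 ≤ q) (h1 : q < 1) :
    HasSum (fun j : ℤ => q ^ j.natAbs) ((1 - q)⁻¹ + q * (1 - q)⁻¹) := by
  have h := hasSum_geometric_of_lt_one h0 h1
  refine HasSum.of_nat_of_neg_add_one ?_ ?_
  · simpa using h
  · have := h.mul_left q
    refine this.congr_fun ?_ |> fun h => h
    intro n
    have : (-((n : ℤ) + 1)).natAbs = n + 1 := by omega
    rw [this, pow_succ']

lemma es_poisson (a t : ℝ) (ha : 0 < a) (ht : 1 ≤ t) (hL : 1 ≤ 2 * π / a) :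
    |a * ∑' k : ℤ, esG a t k - t⁻¹| ≤
      t⁻¹ * (4 * Real.exp (-(2 * π / a)) / (1 - Real.exp (-(2 * π / a)))) := by
  have ht0 : 0 < t := by linarith
  set L := 2 * π / a with hLdef
  set q := Real.exp (-L) with hq
  have hq0 : 0 < q := Real.exp_pos _
  have hq1 : q < 1 := by rw [hq, Real.exp_lt_one_iff]; linarith
  set F : ℤ → ℂ := fun j => FourierTransform.fourier (fun x : ℝ => ((esG a t x : ℝ) : ℂ)) (j : ℝ) with hF
  have hF0 : F 0 = ((a⁻¹ * t⁻¹ : ℝ) : ℂ) := by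
    have := es_fourier a t ha ht0 0
    simp only [hF]
    rw [this]; simp
  have hFj : ∀ j : ℤ, j ≠ 0 → ‖F j‖ ≤ a⁻¹ * t⁻¹ * 2 * q ^ j.natAbs := by
    intro j hj
    simp only [hF]
    rw [es_fourier a t ha ht0 j, norm_mul, norm_mul]
    have e0 : 2 * π * (j : ℝ) / a = j * L := by rw [hLdef]; ring
    have hj1 : (1 : ℝ) ≤ |(j : ℝ)| := by
      exact_mod_cast Int.one_le_abs hj
    have habs : |(j : ℝ) * L| = |(j : ℝ)| * L := by
      rw [abs_mul, abs_of_pos (by linarith : 0 < L)]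
    have e1 := es_gamma_bound (j * L) (by rw [habs]; nlinarith)
    have e2 : Real.exp (-|(j : ℝ) * L|) = q ^ j.natAbs := by
      rw [habs, hq, ← Real.exp_nat_mul, Nat.cast_natAbs]
      congr 1; push_cast; ring
    have e3 : ‖((1 / t : ℂ)) ^ (1 + ((2 * π * j / a : ℝ) : ℂ) * Complex.I)‖ = t⁻¹ := by
      have : (1 / t : ℂ) = ((t⁻¹ : ℝ) : ℂ) := by push_cast; simp
      rw [this, Complex.norm_cpow_eq_rpow_re_of_pos (by positivity)]
      simp
    rw [e3, e0, Complex.norm_real, Real.norm_of_nonneg (by positivity : 0 ≤ a⁻¹)]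
    rw [e2] at e1
    calc a⁻¹ * (t⁻¹ * ‖Complex.Gamma (1 + ((j * L : ℝ) : ℂ) * Complex.I)‖)
        ≤ a⁻¹ * (t⁻¹ * (2 * q ^ j.natAbs)) := by gcongr
      _ = _ := by ring
  have hP := es_hasSum_pow q hq0.le hq1
  have hFs : Summable F := by
    refine Summable.of_norm_bounded (hP.summable.mul_left (a⁻¹ * t⁻¹ * 2)) ?_
    intro j
    by_cases hj : j = 0
    · subst hj
      rw [hF0, Complex.norm_real, Real.norm_of_nonneg (by positivity)]
      have : 0 < a⁻¹ * t⁻¹ := by positivity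
      simp; linarith
    · exact hFj j hj
  have hcont : Continuous (fun x : ℝ => ((esG a t x : ℝ) : ℂ)) := by
    unfold esG; fun_prop
  have hO : (fun x : ℝ => ((esG a t x : ℝ) : ℂ)) =O[Filter.cocompact ℝ] fun x : ℝ => |x| ^ (-(2:ℝ)) := by
    refine Asymptotics.IsBigO.of_bound (4 / a ^ 2) ?_
    have : ∀ᶠ x : ℝ in Filter.cocompact ℝ, x ≠ 0 := by
      have := (isCompact_singleton (x := (0:ℝ))).compl_mem_cocompact
      filter_upwards [this] with x hx
      simpa using hx
    filter_upwards [this] with x hx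
    rw [Complex.norm_real, Real.norm_of_nonneg (by unfold esG; positivity)]
    refine (esG_bound a t x ha ht hx).trans (le_of_eq ?_)
    rw [Real.norm_of_nonneg (by positivity), Real.rpow_neg (abs_nonneg _)]
    simp
  have hmain := Real.tsum_eq_tsum_fourier_of_rpow_decay_of_summable hcont (by norm_num) hO hFs 0
  have hmain2 : ((∑' k : ℤ, esG a t k : ℝ) : ℂ) = ∑' j, F j := by
    rw [Complex.ofReal_tsum]
    simpa using hmain
  have hd := hFs.hasSum.sub (hasSum_ite_eq (0 : ℤ) (F 0))
  have hb := (hP.sub (hasSum_ite_eq (0 : ℤ) (1 : ℝ))).mul_left (a⁻¹ * t⁻¹ * 2)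
  have hle := hd.norm_le_of_bounded hb (by
    intro j
    by_cases hj : j = 0
    · subst hj; simp
    · simpa [hj] using hFj j hj)
  rw [← hmain2, hF0, ← Complex.ofReal_sub, Complex.norm_real, Real.norm_eq_abs] at hle
  have e : a * ∑' k : ℤ, esG a t k - t⁻¹ = a * (∑' k : ℤ, esG a t k - a⁻¹ * t⁻¹) := by
    field_simp
  rw [e, abs_mul, abs_of_pos ha]
  have hq2 : 1 - q ≠ 0 := by linarith
  calc _ ≤ a * (a⁻¹ * t⁻¹ * 2 * ((1 - q)⁻¹ + q * (1 - q)⁻¹ - 1)) := by gcongr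
    _ = _ := by field_simp; ring

lemma es_window (g U V : ℤ → ℝ) (p m : ℤ) (hpm : p ≤ m)
    (hU : ∀ k, m < k → g k ≤ U (k - 1) - U k) (hV : ∀ k, k < p → g k ≤ V (k + 1) - V k) (N : ℕ) :
    ∑ k ∈ Finset.Icc (p - N) (m + N), g k ≤
      ∑ k ∈ Finset.Icc p m, g k + (U m - U (m + N)) + (V p - V (p - N)) := by
  induction N with
  | zero => simp
  | succ N ih =>
    have e : Finset.Icc (p - ((N + 1 : ℕ) : ℤ)) (m + ((N + 1 : ℕ) : ℤ)) =
        insert (p - ((N + 1 : ℕ) : ℤ)) (insert (m + ((N + 1 : ℕ) : ℤ))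
          (Finset.Icc (p - (N : ℤ)) (m + (N : ℤ)))) := by
      ext k; simp only [Finset.mem_Icc, Finset.mem_insert]; push_cast; omega
    rw [e, Finset.sum_insert, Finset.sum_insert]
    · have h1 := hU (m + ((N + 1 : ℕ) : ℤ)) (by push_cast; omega)
      have h2 := hV (p - ((N + 1 : ℕ) : ℤ)) (by push_cast; omega)
      have e1 : m + ((N + 1 : ℕ) : ℤ) - 1 = m + N := by push_cast; ring
      have e2 : p - ((N + 1 : ℕ) : ℤ) + 1 = p - N := by push_cast; ring
      rw [e1] at h1
      rw [e2] at h2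
      linarith
    · simp only [Finset.mem_Icc]; push_cast; omega
    · simp only [Finset.mem_Icc, Finset.mem_insert]; push_cast; omega

lemma es_tail (g U V : ℤ → ℝ) (p m : ℤ) (hpm : p ≤ m) (hg : ∀ k, 0 ≤ g k)
    (hU0 : ∀ k, 0 ≤ U k) (hV0 : ∀ k, 0 ≤ V k)
    (hU : ∀ k, m < k → g k ≤ U (k - 1) - U k) (hV : ∀ k, k < p → g k ≤ V (k + 1) - V k) :
    Summable g ∧ ∑' k, g k ≤ ∑ k ∈ Finset.Icc p m, g k + U m + V p := by
  have key : ∀ s : Finset ℤ, ∑ k ∈ s, g k ≤ ∑ k ∈ Finset.Icc p m, g k + U m + V p := by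
    intro s
    have hN : ∃ N : ℕ, s ⊆ Finset.Icc (p - N) (m + N) := by
      refine ⟨∑ k ∈ s, k.natAbs + p.natAbs + m.natAbs, ?_⟩
      intro k hk
      have h := Finset.single_le_sum (f := fun k : ℤ => k.natAbs) (fun _ _ => Nat.zero_le _) hk
      simp only [Finset.mem_Icc]
      zify at h
      have h1 := abs_le.mp (le_refl |k|)
      have h2 := abs_le.mp (le_refl |p|)
      have h3 := abs_le.mp (le_refl |m|)
      push_cast
      constructor <;> linarith [h1.1, h1.2, h2.1, h2.2, h3.1, h3.2]
    obtain ⟨N, hN⟩ := hN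
    have h1 := Finset.sum_le_sum_of_subset_of_nonneg hN (fun k _ _ => hg k)
    have h2 := es_window g U V p m hpm hU hV N
    have h3 := hU0 (m + N)
    have h4 := hV0 (p - N)
    linarith
  exact ⟨summable_of_sum_le hg key, Real.tsum_le_of_sum_le hg key⟩

lemma es_step (a t x : ℝ) (ha : 0 < a) (ht : 0 < t) (hx : 1 ≤ t * Real.exp (x - a)) :
    a * (Real.exp x * Real.exp (-Real.exp x * t)) ≤
      t⁻¹ * Real.exp (-(t * Real.exp (x - a))) - t⁻¹ * Real.exp (-(t * Real.exp x)) := by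
  obtain ⟨c, hc, h⟩ := exists_hasDerivAt_eq_slope
    (fun y => -(t⁻¹ * Real.exp (-(t * Real.exp y))))
    (fun y => Real.exp y * Real.exp (-(t * Real.exp y))) (by linarith : x - a < x)
    (by fun_prop) (by
      intro y _
      have h1 := ((((Real.hasDerivAt_exp y).const_mul t).neg).exp.const_mul t⁻¹).neg
      have e : Real.exp y * Real.exp (-(t * Real.exp y)) =
          -(t⁻¹ * (Real.exp (-(t * Real.exp y)) * -(t * Real.exp y))) := by field_simp
      rw [e]
      exact h1)
  have e : x - (x - a) = a := by ring
  rw [e, eq_div_iff ha.ne'] at h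
  have h2 : t⁻¹ * Real.exp (-(t * Real.exp (x - a))) - t⁻¹ * Real.exp (-(t * Real.exp x)) =
      Real.exp c * Real.exp (-(t * Real.exp c)) * a := by rw [h]; ring
  rw [h2, mul_comm a]
  refine mul_le_mul_of_nonneg_right ?_ ha.le
  have hc1 : Real.exp (x - a) ≤ Real.exp c := Real.exp_le_exp.mpr hc.1.le
  have hd : Real.exp x = Real.exp c * Real.exp (x - c) := by rw [← Real.exp_add]; congr 1; ring
  have hr := Real.add_one_le_exp (x - c)
  have hr0 : 0 ≤ x - c := by linarith [hc.2]
  set r := Real.exp (x - c)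
  have hy : 1 ≤ t * Real.exp c := hx.trans (by gcongr)
  rw [hd, mul_assoc]
  refine mul_le_mul_of_nonneg_left ?_ (Real.exp_pos _).le
  have h3 : r ≤ Real.exp (r - 1) := by simpa using Real.add_one_le_exp (r - 1)
  calc r * Real.exp (-(Real.exp c * r) * t)
      ≤ Real.exp (r - 1) * Real.exp (-(Real.exp c * r) * t) := by gcongr
    _ = Real.exp (r - 1 + -(Real.exp c * r) * t) := by rw [Real.exp_add]
    _ ≤ _ := by
      rw [Real.exp_le_exp]; nlinarith

set_option maxHeartbeats 2000000 in
/-- Exponential sum approximation of `1/t` by Sinc quadrature. -/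
theorem exponential_sum_approx_inv (δ₀ η T : ℝ)
    (hδ₀ : δ₀ ∈ Set.Ioo (0 : ℝ) 1) (hη : η ∈ Set.Ioo (0 : ℝ) 1)
    (hδstar : δ₀ + η < 1) (hT : 1 < T) :
    let a : ℝ := 2 * Real.pi /
      (Real.log 3 + |Real.log (Real.cos 1)| + |Real.log (δ₀ / 2)|)
    let m : ℤ := ⌈a⁻¹ * Real.log |Real.log (δ₀ / 2)|⌉
    let n : ℤ := ⌈a⁻¹ * (|Real.log (η / 2)| + Real.log T)⌉
    ∀ t ∈ Set.Icc (1 : ℝ) T,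
      |t⁻¹ - a * ∑ k ∈ Finset.Icc (-n) m,
          Real.exp ((k : ℝ) * a) * Real.exp (-Real.exp ((k : ℝ) * a) * t)|
        ≤ (δ₀ + η) * t⁻¹ := by
  intro a m n t htm
  obtain ⟨ht, htT⟩ := htm
  obtain ⟨hd0, hd1⟩ := hδ₀
  obtain ⟨he0, he1⟩ := hη
  have ht0 : 0 < t := by linarith
  have hti : 0 < t⁻¹ := by positivity
  -- constants
  have hc0 : (1 : ℝ) / 2 ≤ Real.cos 1 := by
    have := Real.one_sub_sq_div_two_le_cos (x := 1); norm_num at this; linarith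
  have hc1 := Real.cos_one_le
  have hlc : |Real.log (Real.cos 1)| = -Real.log (Real.cos 1) :=
    abs_of_nonpos (Real.log_nonpos (by linarith) (by linarith))
  have hld : |Real.log (δ₀ / 2)| = -Real.log (δ₀ / 2) :=
    abs_of_nonpos (Real.log_nonpos (by linarith) (by linarith))
  have hle : |Real.log (η / 2)| = -Real.log (η / 2) :=
    abs_of_nonpos (Real.log_nonpos (by linarith) (by linarith))
  set ℓ := |Real.log (δ₀ / 2)| with hℓ
  set L := Real.log 3 + |Real.log (Real.cos 1)| + ℓ with hLdef
  have hlog2 := Real.log_two_gt_d9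
  have hlog2' := Real.log_two_lt_d9
  have hℓ2 : Real.log 2 ≤ ℓ := by
    rw [hld, ← Real.log_inv]; apply Real.log_le_log (by norm_num)
    rw [inv_div, le_div_iff₀ hd0]; linarith
  have hlog3 : 1 ≤ Real.log 3 := by
    rw [Real.le_log_iff_exp_le (by norm_num)]; linarith [Real.exp_one_lt_d9]
  have hlog3' : Real.log 3 ≤ 2 := by
    have := Real.log_le_sub_one_of_pos (show (0:ℝ) < 3 by norm_num); linarith
  have hL1 : 1 ≤ L := by
    have := abs_nonneg (Real.log (Real.cos 1)); linarith
  have hpi := Real.pi_gt_three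
  have ha : 0 < a := by positivity
  have h2pa : 2 * π / a = L := by
    show 2 * π / (2 * π / L) = L
    field_simp
  have hq : Real.exp (-L) = Real.cos 1 * δ₀ / 6 := by
    rw [hLdef, hlc, hld]
    have : -(Real.log 3 + -Real.log (Real.cos 1) + -Real.log (δ₀ / 2)) =
      Real.log (Real.cos 1) + Real.log (δ₀ / 2) - Real.log 3 := by ring
    rw [this, Real.exp_sub, Real.exp_add, Real.exp_log (by linarith), Real.exp_log (by linarith),
      Real.exp_log (by norm_num)]
    ring
  have hma : Real.log ℓ ≤ m * a := by
    have h := Int.le_ceil (a⁻¹ * Real.log ℓ)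
    have h' := mul_le_mul_of_nonneg_right h ha.le
    have e : a⁻¹ * Real.log ℓ * a = Real.log ℓ := by field_simp
    rw [e] at h'; exact h'
  have hℓ0 : 0 < ℓ := by linarith
  have hmexp : ℓ ≤ Real.exp (m * a) := by
    rw [← Real.log_le_iff_le_exp hℓ0]; exact hma
  have hm0 : 0 ≤ m := by
    have : -1 < a⁻¹ * Real.log ℓ := by
      rcases le_total 1 ℓ with h | h
      · have := Real.log_nonneg h
        have : 0 ≤ a⁻¹ * Real.log ℓ := by positivity
        linarith
      · have h1 := Real.one_sub_inv_le_log_of_pos hℓ0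
        have h2 : ℓ⁻¹ ≤ 3 / 2 := by
          rw [inv_le_comm₀ hℓ0 (by norm_num)]; norm_num; linarith
        have h3 : |Real.log (Real.cos 1)| ≤ 1 := by
          rw [hlc, ← Real.log_inv]
          have : Real.log (Real.cos 1)⁻¹ ≤ Real.log 2 := by
            apply Real.log_le_log (by positivity)
            rw [inv_le_comm₀ (by linarith) (by norm_num)]; linarith
          linarith
        have h4 : 1 < a := by
          show 1 < 2 * π / L
          rw [lt_div_iff₀ (by linarith)]; linarith
        have h5 : a⁻¹ ≤ 1 := inv_le_one_of_one_le₀ h4.le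
        have h6 : 0 < a⁻¹ := by positivity
        nlinarith
    have h : -1 < m := by
      apply Int.lt_ceil.mpr; push_cast; exact this
    omega
  have hmexp1 : 1 ≤ Real.exp (m * a) := by
    apply Real.one_le_exp
    have : (0:ℝ) ≤ m := by exact_mod_cast hm0
    positivity
  have hlT : 0 < Real.log T := Real.log_pos hT
  have hn0 : 0 ≤ n := by
    apply Int.ceil_nonneg; positivity
  have hna : Real.exp (((-n : ℤ) : ℝ) * a) ≤ η / 2 * t⁻¹ := by
    have h := Int.le_ceil (a⁻¹ * (|Real.log (η / 2)| + Real.log T))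
    have h' := mul_le_mul_of_nonneg_right h ha.le
    have e : a⁻¹ * (|Real.log (η / 2)| + Real.log T) * a = |Real.log (η / 2)| + Real.log T := by
      field_simp
    rw [e] at h'
    change _ ≤ (n : ℝ) * a at h'
    rw [hle] at h'
    have h2 : ((-n : ℤ) : ℝ) * a ≤ Real.log (η / 2) - Real.log T := by
      push_cast; linarith
    calc _ ≤ Real.exp (Real.log (η / 2) - Real.log T) := Real.exp_le_exp.mpr h2
      _ = η / 2 * T⁻¹ := by
        rw [Real.exp_sub, Real.exp_log (by linarith), Real.exp_log (by linarith), div_eq_mul_inv]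
      _ ≤ _ := by gcongr
  -- tails
  have htail := es_tail
    (fun k : ℤ => a * (Real.exp ((k : ℝ) * a) * Real.exp (-Real.exp ((k : ℝ) * a) * t)))
    (fun k : ℤ => t⁻¹ * Real.exp (-(t * Real.exp ((k : ℝ) * a))))
    (fun k : ℤ => Real.exp ((k : ℝ) * a)) (-n) m (by omega)
    (fun k => by positivity) (fun k => by positivity) (fun k => by positivity)
    (by
      intro k hk
      have e : (((k - 1 : ℤ) : ℝ)) * a = k * a - a := by push_cast; ring
      simp only [e]
      apply es_step a t _ ha ht0
      have h1 : (m : ℝ) * a ≤ k * a - a := by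
        have : (m : ℝ) ≤ k - 1 := by
          have : m ≤ k - 1 := by omega
          exact_mod_cast this
        nlinarith
      have h2 := Real.exp_le_exp.mpr h1
      nlinarith)
    (by
      intro k _
      have e : (((k + 1 : ℤ) : ℝ)) * a = k * a + a := by push_cast; ring
      simp only [e]
      rw [Real.exp_add]
      have h1 := Real.add_one_le_exp a
      have h2 : Real.exp (-Real.exp ((k : ℝ) * a) * t) ≤ 1 := by
        rw [Real.exp_le_one_iff]
        have : 0 < Real.exp ((k : ℝ) * a) * t := by positivity
        linarith
      have h3 := Real.exp_pos ((k : ℝ) * a)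
      calc _ ≤ a * (Real.exp ((k : ℝ) * a) * 1) := by gcongr
        _ ≤ _ := by nlinarith)
  obtain ⟨hsum, htl⟩ := htail
  have hlow := hsum.sum_le_tsum (Finset.Icc (-n) m) (fun k _ => by positivity)
  rw [← Finset.mul_sum] at htl hlow
  have hUm : t⁻¹ * Real.exp (-(t * Real.exp ((m : ℝ) * a))) ≤ δ₀ / 2 * t⁻¹ := by
    have : Real.exp (-(t * Real.exp ((m : ℝ) * a))) ≤ δ₀ / 2 := by
      calc _ ≤ Real.exp (-ℓ) := by rw [Real.exp_le_exp]; nlinarith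
        _ = δ₀ / 2 := by rw [hld, neg_neg, Real.exp_log (by linarith)]
    nlinarith
  have hP := es_poisson a t ha ht (by rw [h2pa]; exact hL1)
  rw [h2pa, hq] at hP
  have hre : ∑' k : ℤ, a * (Real.exp ((k : ℝ) * a) * Real.exp (-Real.exp ((k : ℝ) * a) * t))
      = a * ∑' k : ℤ, esG a t k := by
    rw [tsum_mul_left, ← (Equiv.neg ℤ).tsum_eq]
    congr 1
    apply tsum_congr
    intro k
    have e : (((Equiv.neg ℤ) k : ℤ) : ℝ) * a = -a * k := by simp; ring
    rw [e, esG]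
    congr 2; ring
  rw [hre] at htl hlow
  have hfrac : t⁻¹ * (4 * (Real.cos 1 * δ₀ / 6) / (1 - Real.cos 1 * δ₀ / 6)) ≤ δ₀ / 2 * t⁻¹ := by
    rw [mul_comm]
    refine mul_le_mul_of_nonneg_right ?_ hti.le
    have : Real.cos 1 * δ₀ ≤ 5 / 9 := by nlinarith
    rw [div_le_iff₀ (by linarith)]
    nlinarith
  have hP' := abs_le.mp (hP.trans hfrac)
  have hee : 0 < η * t⁻¹ := by positivity
  have hdd : 0 < δ₀ * t⁻¹ := by positivity
  rw [abs_le]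
  constructor
  · linarith [hP'.1, hP'.2]
  · linarith [hP'.1, hP'.2]
end
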